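/- Let q ≡ 1 (mod 5). Then, as complex numbers, the number of tuples (x_1,x_2,x_3,y) ∈ F_q^4 with y^5 = x_1 x_2 x_3 (1 − x_1 − x_2 − x_3) equals q^3 + Σ_χ (1/q)·G(φ,χ)^5, where the sum runs over all nontrivial multiplicative characters χ of F_q^* with χ^5 = 1. -/

import Mathlib

/-- The Gauss sum `G(φ, χ) = ∑_{x ∈ F*} φ(x) χ(x)`. -/
noncomputable def gaussSum' {F : Type*} [Field F] [Fintype F]
    (φ : AddChar F ℂ) (χ : MulChar F ℂ) : ℂ :=
  letI := Classical.decEq F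
  ∑ x : Fˣ, φ (x : F) * χ (x : F)

/-- The group of multiplicative characters of a finite field with values in `ℂ` is finite. -/
noncomputable instance {F : Type*} [Field F] [Fintype F] : Fintype (MulChar F ℂ) :=
  Fintype.ofFinite _

section CharacterSums

variable {F : Type*} [Field F] [Fintype F]

lemma gaussSum'_eq_gaussSum (φ : AddChar F ℂ) (χ : MulChar F ℂ) :
    gaussSum' φ χ = gaussSum χ φ := by
  classical
  rw [gaussSum, ← Finset.sum_subset (Finset.subset_univ (Finset.univ.erase (0 : F)))
    (fun x _ hx ↦ by
      have : x = 0 := by simpa using hx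
      rw [this, MulChar.map_zero, zero_mul])]
  refine Finset.sum_bij (fun (x : Fˣ) _ ↦ (x : F)) (by simp)
    (fun _ _ _ _ h ↦ Units.ext h) (fun x hx ↦ ⟨Units.mk0 x (Finset.ne_of_mem_erase hx), by simp⟩) fun x _ ↦ mul_comm _ _

/-- Characters of exponent `n` detect `n`-th powers. -/
lemma MulChar.exists_pow_eq_one_apply_ne_one (n : ℕ) {a : Fˣ} (ha : ∀ b : Fˣ, b ^ n ≠ a) :
    ∃ χ : MulChar F ℂ, χ ^ n = 1 ∧ χ a ≠ 1 := by
  let H : Subgroup Fˣ := (powMonoidHom n : Fˣ →* Fˣ).range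
  have haH : (a : Fˣ ⧸ H) ≠ 1 := by
    rw [ne_eq, QuotientGroup.eq_one_iff]
    rintro ⟨b, hb⟩
    exact ha b hb
  obtain ⟨f, hf⟩ := CommGroup.exists_apply_ne_one_of_hasEnoughRootsOfUnity (Fˣ ⧸ H) ℂ haH
  refine ⟨MulChar.ofUnitHom (f.comp (QuotientGroup.mk' H)), ?_, ?_⟩
  · refine MulChar.eq_one_iff.mpr fun u ↦ ?_
    have hu : ((u ^ n : Fˣ) : Fˣ ⧸ H) = 1 := (QuotientGroup.eq_one_iff _).mpr ⟨u, rfl⟩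
    rw [MulChar.pow_apply_coe, MulChar.ofUnitHom_coe, ← Units.val_pow_eq_pow_val, ← map_pow]
    simp [hu, -QuotientGroup.mk_pow]
  · simpa [MulChar.ofUnitHom_coe] using hf

lemma MulChar.card_pow_eq_one (n : ℕ) :
    Nat.card {χ : MulChar F ℂ // χ ^ n = 1} = Nat.card {u : Fˣ // u ^ n = 1} := by
  obtain ⟨e⟩ := MulChar.mulEquiv_units F ℂ
  refine Nat.card_congr (e.toEquiv.subtypeEquiv fun χ ↦ ?_)
  rw [MulEquiv.toEquiv_eq_coe, EquivLike.coe_coe, ← map_pow, MulEquiv.map_eq_one_iff]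

open scoped Classical in
lemma MulChar.sum_pow_eq_one_apply_unit (n : ℕ) (a : Fˣ) :
    ∑ χ : MulChar F ℂ with χ ^ n = 1, χ a = Nat.card {b : Fˣ // b ^ n = a} := by
  by_cases h : ∃ b : Fˣ, b ^ n = a
  · obtain ⟨b, rfl⟩ := h
    have hcard : Nat.card {c : Fˣ // c ^ n = b ^ n} = Nat.card {u : Fˣ // u ^ n = 1} :=
      Nat.card_congr ((Equiv.mulRight b⁻¹).subtypeEquiv fun c ↦ by
        simp [mul_pow, mul_inv_eq_one])
    rw [hcard, ← MulChar.card_pow_eq_one, Finset.sum_congr rfl (g := fun _ ↦ (1 : ℂ)),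
      Finset.sum_const, Nat.card_eq_fintype_card, Fintype.card_subtype, nsmul_one]
    intro χ hχ
    rw [Units.val_pow_eq_pow_val, map_pow, ← MulChar.pow_apply_coe,
      (Finset.mem_filter.mp hχ).2, MulChar.one_apply_coe]
  · push Not at h
    obtain ⟨ψ, hψ, hψa⟩ := MulChar.exists_pow_eq_one_apply_ne_one n h
    have : IsEmpty {b : Fˣ // b ^ n = a} := ⟨fun b ↦ h b b.2⟩
    rw [Nat.card_of_isEmpty, Nat.cast_zero]
    refine eq_zero_of_mul_eq_self_left hψa ?_
    rw [Finset.mul_sum]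
    refine Finset.sum_bijective (ψ * ·) (Group.mulLeft_bijective ψ) (fun χ ↦ ?_) fun χ _ ↦ rfl
    simp [mul_pow, hψ]

open scoped Classical in
/-- The number of `n`-th roots of `a` in a finite field is a sum over characters of
exponent `n`. -/
lemma MulChar.card_pow_eq (n : ℕ) [NeZero n] (a : F) :
    (Nat.card {y : F // y ^ n = a} : ℂ) =
      1 + ∑ χ : MulChar F ℂ with χ ≠ 1 ∧ χ ^ n = 1, χ a := by
  have hn : n ≠ 0 := NeZero.ne n
  rcases eq_or_ne a 0 with rfl | ha
  · have hcard : Nat.card {y : F // y ^ n = 0} = 1 := by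
      simp only [pow_eq_zero_iff hn, Nat.card_unique]
    rw [hcard, Finset.sum_eq_zero fun χ _ ↦ χ.map_zero, Nat.cast_one, add_zero]
  · lift a to Fˣ using ha.isUnit
    have hcard : Nat.card {y : F // y ^ n = a} = Nat.card {b : Fˣ // b ^ n = a} := by
      refine (Nat.card_congr (Equiv.ofBijective
        (fun b ↦ ⟨(b.1 : F), by exact_mod_cast congrArg Units.val b.2⟩) ⟨?_, ?_⟩)).symm
      · intro b c h
        exact Subtype.ext (Units.ext (congrArg Subtype.val h))
      · rintro ⟨y, hy⟩
        have hy0 : y ≠ 0 := by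
          rintro rfl
          rw [zero_pow hn] at hy
          exact a.ne_zero hy.symm
        exact ⟨⟨Units.mk0 y hy0, Units.ext hy⟩, rfl⟩
    have hfilter : (Finset.univ.filter fun χ : MulChar F ℂ ↦ χ ≠ 1 ∧ χ ^ n = 1) =
        (Finset.univ.filter fun χ : MulChar F ℂ ↦ χ ^ n = 1).erase 1 := by
      ext χ
      simp
    rw [hcard, ← MulChar.sum_pow_eq_one_apply_unit, hfilter,
      ← Finset.add_sum_erase _ _ (a := (1 : MulChar F ℂ)) (by simp), MulChar.one_apply_coe]

/-- The Jacobi sum over `x + y = s`, for an arbitrary right-hand side `s`. -/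
lemma sum_mul_apply_sub {R : Type*} [CommRing R] [IsDomain R] {χ ψ : MulChar F R}
    (h : χ * ψ ≠ 1) (s : F) :
    ∑ x, χ x * ψ (s - x) = (χ * ψ) s * jacobiSum χ ψ := by
  rcases eq_or_ne s 0 with rfl | hs
  · rw [MulChar.map_zero, zero_mul]
    calc ∑ x, χ x * ψ (0 - x) = ∑ x, ψ (-1) * (χ * ψ) x := by
          refine Finset.sum_congr rfl fun x _ ↦ ?_
          rw [zero_sub, neg_eq_neg_one_mul, map_mul, MulChar.mul_apply]
          ring
      _ = 0 := by rw [← Finset.mul_sum, MulChar.sum_eq_zero_of_ne_one h, mul_zero]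
  · rw [jacobiSum, Finset.mul_sum]
    refine (Fintype.sum_equiv (Equiv.mulLeft₀ s hs) _ _ fun x ↦ ?_).symm
    rw [Equiv.mulLeft₀_apply, show s - s * x = s * (1 - x) by ring, map_mul, map_mul,
      MulChar.mul_apply]
    ring

lemma sum_mul_mul_mul_apply_one_sub {R : Type*} [CommRing R] [IsDomain R] {χ : MulChar F R}
    (h : 4 < orderOf χ) :
    ∑ x, ∑ y, ∑ z, χ (x * y * z * (1 - x - y - z)) =
      ∏ i ∈ Finset.Ico 1 4, jacobiSum χ (χ ^ i) := by
  have hne {i : ℕ} (hi : i + 1 ≤ 4) : χ * χ ^ i ≠ 1 := by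
    rw [← pow_succ']
    exact pow_ne_one_of_lt_orderOf i.succ_ne_zero (by lia)
  have hz (x y : F) : ∑ z, χ (x * y * z * (1 - x - y - z)) =
      χ x * (χ y * (χ ^ 2) (1 - x - y)) * jacobiSum χ (χ ^ 1) := by
    rw [pow_succ' χ 1, mul_assoc (χ x), mul_assoc (χ y), ← sum_mul_apply_sub (hne (by lia)),
      Finset.mul_sum, Finset.mul_sum]
    refine Finset.sum_congr rfl fun z _ ↦ ?_
    simp only [map_mul, pow_one]
    ring
  have hy (x : F) : ∑ y, χ x * (χ y * (χ ^ 2) (1 - x - y)) * jacobiSum χ (χ ^ 1) =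
      χ x * (χ ^ 3) (1 - x) * jacobiSum χ (χ ^ 2) * jacobiSum χ (χ ^ 1) := by
    rw [pow_succ' χ 2, mul_assoc (χ x), ← sum_mul_apply_sub (hne (by lia)), ← Finset.sum_mul,
      Finset.mul_sum]
  simp only [hz, hy]
  rw [← Finset.sum_mul, ← Finset.sum_mul, ← jacobiSum, Finset.prod_Ico_succ_top (by lia),
    Finset.prod_Ico_succ_top (by lia), Finset.prod_Ico_succ_top (by lia)]
  simp only [Finset.Ico_self, Finset.prod_empty, one_mul]
  ring

lemma gaussSum_pow_five {χ : MulChar F ℂ} (hχ : χ ≠ 1) (hχ5 : χ ^ 5 = 1) {φ : AddChar F ℂ}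
    (hφ : φ ≠ 1) :
    gaussSum χ φ ^ 5 =
      Fintype.card F * ∑ x, ∑ y, ∑ z, χ (x * y * z * (1 - x - y - z)) := by
  have : Fact (Nat.Prime 5) := ⟨by norm_num⟩
  have horder : orderOf χ = 5 := orderOf_eq_prime hχ5 hχ
  have h := gaussSum_pow_eq_prod_jacobiSum (χ := χ) (by lia) (AddChar.IsPrimitive.of_ne_one hφ)
  rw [horder, MulChar.val_neg_one_eq_one_of_odd_order (by decide) hχ5, one_mul] at h
  rw [h, sum_mul_mul_mul_apply_one_sub (by lia)]

end CharacterSums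

open scoped Classical in
/-- Let `F` be a finite field with `q ≡ 1 (mod 5)` elements of
characteristic `p ≠ 5` and let `φ` be a nontrivial additive character of `F` with values
in `ℂ`. The number of tuples `(x₁, x₂, x₃, y) ∈ F⁴` with
`y⁵ = x₁x₂x₃(1 - x₁ - x₂ - x₃)` equals `q³ + ∑_χ (1/q) G(φ,χ)⁵`, the sum running over
all nontrivial multiplicative characters `χ` of `F` with `χ⁵ = 1`. -/
theorem stmt_12 {F : Type*} [Field F] [Fintype F] (hchar : ringChar F ≠ 5)
    (hq : Fintype.card F % 5 = 1) (φ : AddChar F ℂ) (hφ : φ ≠ 1) :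
    (Nat.card {t : F × F × F × F //
        t.2.2.2 ^ 5 = t.1 * t.2.1 * t.2.2.1 * (1 - t.1 - t.2.1 - t.2.2.1)} : ℂ) =
      (Fintype.card F : ℂ) ^ 3 +
        ∑ χ ∈ Finset.univ.filter (fun χ : MulChar F ℂ => χ ≠ 1 ∧ χ ^ 5 = 1),
          (1 / (Fintype.card F : ℂ)) * gaussSum' φ χ ^ 5 := by
  have hcard : Nat.card {t : F × F × F × F //
        t.2.2.2 ^ 5 = t.1 * t.2.1 * t.2.2.1 * (1 - t.1 - t.2.1 - t.2.2.1)} =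
      ∑ x : F, ∑ y : F, ∑ z : F,
        Nat.card {w : F // w ^ 5 = x * y * z * (1 - x - y - z)} := by
    simp only [Nat.card_eq_fintype_card, Fintype.card_subtype, Finset.card_filter,
      Fintype.sum_prod_type]
  have hq0 : (Fintype.card F : ℂ) ≠ 0 := Nat.cast_ne_zero.mpr Fintype.card_ne_zero
  rw [hcard]
  push_cast
  simp only [MulChar.card_pow_eq, Finset.sum_add_distrib, Finset.sum_const, Finset.card_univ,
    nsmul_eq_mul, mul_one]
  congr 1
  · ring
  · simp only [Finset.sum_comm (s := Finset.univ (α := F))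
      (t := Finset.univ.filter fun χ : MulChar F ℂ ↦ χ ≠ 1 ∧ χ ^ 5 = 1)]
    refine Finset.sum_congr rfl fun χ hχ ↦ ?_
    obtain ⟨hχ1, hχ5⟩ := (Finset.mem_filter.mp hχ).2
    rw [gaussSum'_eq_gaussSum, gaussSum_pow_five hχ1 hχ5 hφ, one_div,
      inv_mul_cancel_left₀ hq0]
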